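/- Let (R, m) be a Gorenstein local ring and M a maximal Cohen–Macaulay R-module with no free direct summand. Let I be an ideal generated by a system of parameters for R and let Δ ∈ R represent the socle of R/I (i.e., (I : m) = (I, Δ)). Then Δ·M ⊆ I·M. -/

import Mathlib

open IsLocalRing

/-- `I` is `m`-primary: a proper ideal containing a power of the maximal ideal. -/
def IsMPrimary {R : Type*} [CommRing R] [IsLocalRing R] (I : Ideal R) : Prop :=
  I ≠ ⊤ ∧ ∃ n : ℕ, maximalIdeal R ^ n ≤ I

/-- A list of elements of a local ring is a system of parameters if it has
`dim R` elements and generates an `m`-primary ideal. -/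
def IsSOP {R : Type*} [CommRing R] [IsLocalRing R] (xs : List R) : Prop :=
  (xs.length : WithBot ℕ∞) = ringKrullDim R ∧ IsMPrimary (Ideal.ofList xs)

/-- A Noetherian local ring is Gorenstein iff it is Cohen–Macaulay (some system of
parameters is a regular sequence) and some parameter ideal is irreducible. -/
def IsGorensteinLocal (R : Type*) [CommRing R] [IsLocalRing R] : Prop :=
  ∃ xs : List R, IsSOP xs ∧ RingTheory.Sequence.IsRegular R xs ∧ InfIrred (Ideal.ofList xs)

/-- `M` is a maximal Cohen–Macaulay module: every system of parameters of `R`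
is a regular sequence on `M`. -/
def IsMaximalCM (R : Type*) [CommRing R] [IsLocalRing R]
    (M : Type*) [AddCommGroup M] [Module R M] : Prop :=
  ∀ xs : List R, IsSOP xs → RingTheory.Sequence.IsRegular M xs

namespace SocAux

open scoped Pointwise

theorem wr_exch {R : Type*} [CommRing R] (L : List R) (y z : R) (n : ℕ)
    (h : RingTheory.Sequence.IsWeaklyRegular R (L ++ [y]))
    (hy : y ^ n ∈ Ideal.ofList L ⊔ Ideal.span {z}) :
    RingTheory.Sequence.IsWeaklyRegular R (L ++ [z]) := by
  rw [RingTheory.Sequence.isWeaklyRegular_append_iff,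
    RingTheory.Sequence.isWeaklyRegular_singleton_iff] at h ⊢
  refine ⟨h.1, ?_⟩
  have h2 := h.2.pow n
  obtain ⟨l, hl, w, hw, e⟩ := Submodule.mem_sup.mp hy
  obtain ⟨a, rfl⟩ := Ideal.mem_span_singleton'.mp hw
  refine IsSMulRegular.of_mul (a := a) ?_
  intro u v huv
  apply h2
  have hk : ∀ q : R ⧸ (Ideal.ofList L • ⊤ : Submodule R R), l • q = 0 := by
    intro q
    obtain ⟨q, rfl⟩ := Submodule.mkQ_surjective _ q
    rw [← map_smul, Submodule.mkQ_apply, Submodule.Quotient.mk_eq_zero]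
    exact Submodule.smul_mem_smul hl trivial
  simp only [← e, add_smul, hk, zero_add]
  exact huv

theorem rad_exch {R : Type*} [CommRing R] [IsLocalRing R] [IsNoetherianRing R]
    (L : List R) (y z : R) (hL : ∀ a ∈ L, a ∈ maximalIdeal R) (hy : y ∈ maximalIdeal R)
    (h : maximalIdeal R ≤ (Ideal.ofList (L ++ [y])).radical)
    (hz : ∀ p ∈ (Ideal.ofList L).minimalPrimes, z ∉ p) :
    maximalIdeal R ≤ (Ideal.ofList (L ++ [z])).radical := by
  rw [Ideal.radical_eq_sInf]
  refine le_sInf ?_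
  rintro p ⟨hp, hpp⟩
  by_contra hne
  have hlt : p < maximalIdeal R :=
    lt_of_le_of_ne (le_maximalIdeal hpp.ne_top) (fun h => hne h.ge)
  have hLp : {r | r ∈ L} ⊆ (p : Set R) := fun a ha => hp (Ideal.subset_span (by
    exact List.mem_append.mpr (Or.inl ha)))
  have hset : {r | r ∈ L ++ [y]} = insert y {r | r ∈ L} := by
    ext r; simp [or_comm]
  have hmin : maximalIdeal R ∈ (Ideal.span (insert y {r | r ∈ L})).minimalPrimes := by
    refine ⟨⟨inferInstance, ?_⟩, ?_⟩
    · rw [Ideal.span_le]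
      rintro a (rfl | ha)
      · exact hy
      · exact hL a ha
    · rintro q ⟨hq, hq2⟩ _
      refine h.trans ?_
      unfold Ideal.ofList
      rw [hset]
      exact hq.radical_le_iff.mpr hq2
  have := Ideal.mem_minimalPrimes_span_of_mem_minimalPrimes_span_insert hlt y
    {r | r ∈ L} hmin {r | r ∈ L} hLp
    (fun a ha => Ideal.le_radical (Ideal.subset_span (Or.inr ha)))
  exact hz p this (hp (Ideal.subset_span (by simp)))

theorem not_min {R : Type*} [CommRing R] [IsLocalRing R] [IsNoetherianRing R]
    (L : List R) (h : ((L.length + 1 : ℕ) : WithBot ℕ∞) ≤ ringKrullDim R) :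
    maximalIdeal R ∉ (Ideal.ofList L).minimalPrimes := by
  classical
  intro hm
  have h1 : (maximalIdeal R).height ≤ (L.toFinset.card : ℕ∞) := by
    apply Ideal.height_le_card_of_mem_minimalPrimes_span_finset
    convert hm using 3
    ext; simp
  rw [← maximalIdeal_height_eq_ringKrullDim] at h
  have h2 : ((L.length + 1 : ℕ) : ℕ∞) ≤ (maximalIdeal R).height := by exact_mod_cast h
  have h3 : ((L.length + 1 : ℕ) : ℕ∞) ≤ (L.length : ℕ∞) :=
    h2.trans (h1.trans (by exact_mod_cast L.toFinset_card_le))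
  have : L.length + 1 ≤ L.length := by exact_mod_cast h3
  omega

theorem avoid {R : Type*} [CommRing R] [IsLocalRing R] [IsNoetherianRing R]
    (I J : Ideal R) (hI : maximalIdeal R ∉ I.minimalPrimes)
    (hJ : maximalIdeal R ∉ J.minimalPrimes) :
    ∃ z ∈ maximalIdeal R, (∀ p ∈ I.minimalPrimes, z ∉ p) ∧ ∀ p ∈ J.minimalPrimes, z ∉ p := by
  classical
  have hf : (I.minimalPrimes ∪ J.minimalPrimes).Finite :=
    (Ideal.finite_minimalPrimes_of_isNoetherianRing R I).union
      (Ideal.finite_minimalPrimes_of_isNoetherianRing R J)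
  by_contra! hcon
  have hsub : ((maximalIdeal R : Ideal R) : Set R) ⊆ ⋃ i ∈ (↑hf.toFinset : Set (Ideal R)), ((id i : Ideal R) : Set R) := by
    intro z hz
    simp only [Set.mem_iUnion]
    by_cases h : ∀ p ∈ I.minimalPrimes, z ∉ p
    · obtain ⟨p, hp, hzp⟩ := hcon z hz h
      exact ⟨p, by simp [hp], hzp⟩
    · push Not at h
      obtain ⟨p, hp, hzp⟩ := h
      exact ⟨p, by simp [hp], hzp⟩
  have hprime : ∀ p ∈ hf.toFinset, (id p : Ideal R).IsPrime := by
    intro p hp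
    rw [Set.Finite.mem_toFinset] at hp
    rcases hp with hp | hp <;> exact hp.1.1
  obtain ⟨p, hp, hle⟩ := (Ideal.subset_union_prime (s := hf.toFinset) (f := id) ⊥ ⊥
    (fun p hp _ _ => hprime p hp)).mp hsub
  have heq : maximalIdeal R = p :=
    le_antisymm hle (le_maximalIdeal (hprime p hp).ne_top)
  rw [Set.Finite.mem_toFinset] at hp
  rcases hp with hp | hp
  · exact hI (heq ▸ hp)
  · exact hJ (heq ▸ hp)

theorem ofList_perm {R : Type*} [CommRing R] {L L' : List R} (h : L.Perm L') :
    Ideal.ofList L = Ideal.ofList L' :=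
  congrArg Ideal.span (Set.ext fun _ => h.mem_iff)

theorem cm_aux {R : Type*} [CommRing R] [IsLocalRing R] [IsNoetherianRing R] (xs : List R) :
    ∀ zs ys : List R, ys.length = xs.length →
    ((zs.length + xs.length : ℕ) : WithBot ℕ∞) = ringKrullDim R →
    (∀ a ∈ zs, a ∈ maximalIdeal R) → (∀ a ∈ ys, a ∈ maximalIdeal R) →
    (∀ a ∈ xs, a ∈ maximalIdeal R) →
    RingTheory.Sequence.IsWeaklyRegular R (zs ++ ys) →
    maximalIdeal R ≤ (Ideal.ofList (zs ++ ys)).radical →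
    maximalIdeal R ≤ (Ideal.ofList (zs ++ xs)).radical →
    RingTheory.Sequence.IsWeaklyRegular R (zs ++ xs) := by
  induction xs with
  | nil =>
    intro zs ys h _ _ _ _ h1 _ _
    rw [List.length_nil, List.length_eq_zero_iff] at h
    subst h; exact h1
  | cons x xs ih =>
    intro zs ys hlen hdim hzs hys hxs hreg hry hrx
    obtain _ | ⟨y, ys⟩ := ys
    · simp at hlen
    simp only [List.length_cons, Nat.add_right_cancel_iff] at hlen
    simp only [List.mem_cons, forall_eq_or_imp] at hys hxs
    have py : (zs ++ y :: ys).Perm (zs ++ ys ++ [y]) := by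
      rw [List.append_assoc]
      exact (List.perm_append_singleton y ys).symm.append_left zs
    have px : ∀ x : R, (zs ++ x :: xs).Perm (zs ++ xs ++ [x]) := by
      intro x
      rw [List.append_assoc]
      exact (List.perm_append_singleton x xs).symm.append_left zs
    have mem : ∀ l : List R, (∀ a ∈ l, a ∈ maximalIdeal R) →
        ∀ a ∈ zs ++ l, a ∈ maximalIdeal R := by
      intro l hl a ha
      rcases List.mem_append.mp ha with h | h
      · exact hzs a h
      · exact hl a h
    obtain ⟨z, hz, hz1, hz2⟩ := avoid (Ideal.ofList (zs ++ ys)) (Ideal.ofList (zs ++ xs))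
      (not_min _ (by rw [← hdim]; simp [hlen, add_assoc]))
      (not_min _ (by rw [← hdim]; simp [add_assoc]))
    have pz : ∀ l : List R, (zs ++ l ++ [z]).Perm (zs ++ [z] ++ l) := by
      intro l
      rw [List.append_assoc, List.append_assoc]
      exact (List.perm_append_comm).append_left zs
    have key : ∀ l : List R, ∀ u v : R, u ∈ maximalIdeal R →
        maximalIdeal R ≤ (Ideal.ofList (zs ++ l ++ [v])).radical →
        RingTheory.Sequence.IsWeaklyRegular R (zs ++ l ++ [u]) →
        RingTheory.Sequence.IsWeaklyRegular R (zs ++ l ++ [v]) := by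
      intro l u v hu hv hr
      obtain ⟨n, hn⟩ := hv hu
      refine wr_exch _ u v n hr ?_
      rwa [Ideal.ofList_append, Ideal.ofList_singleton] at hn
    rw [ofList_perm py] at hry
    rw [ofList_perm (px x)] at hrx
    have ry := rad_exch _ y z (mem ys hys.2) hys.1 hry hz1
    have rx := rad_exch _ x z (mem xs hxs.2) hxs.1 hrx hz2
    have r1 := isWeaklyRegular_of_perm_of_subset_maximalIdeal hreg py
      (mem _ (by simpa using hys))
    have r2 := key ys y z hys.1 ry r1
    have r3 := isWeaklyRegular_of_perm_of_subset_maximalIdeal r2 (pz ys) (by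
      rw [List.append_assoc]
      refine mem _ ?_
      intro a ha
      rcases List.mem_append.mp ha with h | h
      · exact hys.2 a h
      · rw [List.mem_singleton.mp h]; exact hz)
    have hzs' : ∀ a ∈ zs ++ [z], a ∈ maximalIdeal R := by
      refine mem _ ?_
      simpa using hz
    have r4 := ih (zs ++ [z]) ys hlen (by rw [← hdim]; simp; ring) hzs' hys.2 hxs.2 r3
      (by rwa [← ofList_perm (pz ys)]) (by rwa [← ofList_perm (pz xs)])
    have r5 := isWeaklyRegular_of_perm_of_subset_maximalIdeal r4 (pz xs).symm (by
      intro a ha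
      rcases List.mem_append.mp ha with h | h
      · exact hzs' a h
      · exact hxs.2 a h)
    have r6 := key xs z x hz hrx r5
    exact isWeaklyRegular_of_perm_of_subset_maximalIdeal r6 (px x).symm (by
      rw [List.append_assoc]
      refine mem _ ?_
      intro a ha
      rcases List.mem_append.mp ha with h | h
      · exact hxs.2 a h
      · rw [List.mem_singleton.mp h]; exact hxs.1)

end SocAux
namespace SocAux

open scoped Pointwise

theorem hom_simple_length {A : Type*} [CommRing A] [IsLocalRing A] (s : A)
    (hs : ∀ m ∈ maximalIdeal A, m * s = 0)
    (hs' : ∀ a : A, (∀ m ∈ maximalIdeal A, m * a = 0) → a ∈ Ideal.span {s})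
    (T : Type*) [AddCommGroup T] [Module A T] [IsSimpleModule A T] :
    Module.length A (T →ₗ[A] A) ≤ 1 := by
  rcases subsingleton_or_nontrivial (T →ₗ[A] A) with h | h
  · rw [Module.length_eq_zero]; exact zero_le_one
  have hT := isSimpleModule_iff_toSpanSingleton_surjective.mp (inferInstance : IsSimpleModule A T)
  obtain ⟨hT1, hT2⟩ := hT
  obtain ⟨t, ht⟩ := exists_ne (0 : T)
  have hsurj := hT2 t ht
  have hmt : ∀ m ∈ maximalIdeal A, m • t = 0 := by
    intro m hm
    by_contra hne
    obtain ⟨a, ha⟩ := hT2 _ hne t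
    rw [LinearMap.toSpanSingleton_apply, smul_smul] at ha
    have hu : IsUnit (1 - a * m) := by
      by_contra hu
      have h1 : (1 - a * m) + a * m ∈ maximalIdeal A :=
        Ideal.add_mem _ ((mem_maximalIdeal _).mpr hu) (Ideal.mul_mem_left _ _ hm)
      rw [sub_add_cancel] at h1
      exact (Ideal.ne_top_iff_one _).mp (maximalIdeal.isMaximal A).ne_top h1
    have : (1 - a * m) • t = 0 := by rw [sub_smul, one_smul, ha, sub_self]
    exact ht (hu.smul_eq_zero.mp this)
  have hval : ∀ f : T →ₗ[A] A, ∃ a, a * s = f t := by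
    intro f
    apply Ideal.mem_span_singleton'.mp
    apply hs'
    intro m hm
    rw [← smul_eq_mul, ← map_smul, hmt m hm, map_zero]
  have : IsSimpleModule A (T →ₗ[A] A) := by
    rw [isSimpleModule_iff_toSpanSingleton_surjective]
    refine ⟨h, ?_⟩
    intro f hf g
    obtain ⟨a, ha⟩ := hval f
    obtain ⟨b, hb⟩ := hval g
    have hau : IsUnit a := by
      by_contra hu
      apply hf
      ext u
      obtain ⟨c, rfl⟩ := hsurj u
      rw [LinearMap.toSpanSingleton_apply, map_smul, ← ha, hs a ((mem_maximalIdeal _).mpr hu)]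
      simp
    obtain ⟨a', ha'⟩ := hau.exists_left_inv
    refine ⟨b * a', ?_⟩
    ext u
    obtain ⟨c, rfl⟩ := hsurj u
    simp only [LinearMap.toSpanSingleton_apply, map_smul, LinearMap.smul_apply, smul_eq_mul]
    rw [← ha, ← hb]
    linear_combination (c * b * s) * ha'
  exact (Module.length_eq_one _ _).le

theorem length_hom_add {A : Type*} [CommRing A] (P : Type*) [AddCommGroup P] [Module A P]
    (N : Submodule A P) :
    Module.length A (P →ₗ[A] A) = Module.length A ((P ⧸ N) →ₗ[A] A) +
      Module.length A (LinearMap.range (LinearMap.lcomp A A N.subtype)) := by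
  refine Module.length_eq_add_of_exact (LinearMap.lcomp A A N.mkQ)
    (LinearMap.lcomp A A N.subtype).rangeRestrict ?_ (LinearMap.surjective_rangeRestrict _) ?_
  · intro f g h
    apply LinearMap.ext
    intro x
    obtain ⟨x, rfl⟩ := N.mkQ_surjective x
    exact LinearMap.congr_fun h x
  · intro f
    constructor
    · intro h
      have h' : (LinearMap.lcomp A A N.subtype) f = 0 := congrArg Subtype.val h
      refine ⟨N.liftQ f ?_, ?_⟩
      · intro x hx
        exact LinearMap.congr_fun h' ⟨x, hx⟩
      · ext x; rfl
    · rintro ⟨g, rfl⟩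
      apply Subtype.ext
      ext x
      have hx : N.mkQ (x : P) = 0 := (Submodule.Quotient.mk_eq_zero N).mpr x.2
      change g (N.mkQ (x : P)) = 0
      rw [hx, map_zero]

theorem hom_length_le {A : Type*} [CommRing A] [IsLocalRing A] (s : A)
    (hs : ∀ m ∈ maximalIdeal A, m * s = 0)
    (hs' : ∀ a : A, (∀ m ∈ maximalIdeal A, m * a = 0) → a ∈ Ideal.span {s})
    (P : Type*) [AddCommGroup P] [Module A P] (hP : IsFiniteLength A P) :
    Module.length A (P →ₗ[A] A) ≤ Module.length A P := by
  induction hP with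
  | of_subsingleton => rw [Module.length_eq_zero]; exact zero_le
  | @of_simple_quotient P _ _ N _ _ ih =>
    rw [length_hom_add P N, Module.length_eq_add_of_exact N.subtype N.mkQ N.subtype_injective
      N.mkQ_surjective (LinearMap.exact_subtype_mkQ N), add_comm]
    refine add_le_add ((Module.length_le_of_injective _ (Submodule.subtype_injective _)).trans ih) ?_
    rw [Module.length_eq_one A (P ⧸ N)]
    exact hom_simple_length s hs hs' _

theorem baer {A : Type*} [CommRing A] [IsLocalRing A] [IsArtinianRing A] (s : A)
    (hs : ∀ m ∈ maximalIdeal A, m * s = 0)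
    (hs' : ∀ a : A, (∀ m ∈ maximalIdeal A, m * a = 0) → a ∈ Ideal.span {s}) :
    Module.Baer A A := by
  rw [Module.Baer.iff_surjective]
  intro J
  rw [← LinearMap.range_eq_top]
  by_contra hne
  have fl : ∀ (P : Type _) [AddCommGroup P] [Module A P] [Module.Finite A P], IsFiniteLength A P :=
    fun P _ _ _ => isFiniteLength_iff_isNoetherian_isArtinian.mpr ⟨inferInstance, inferInstance⟩
  have h1 := length_hom_add A J
  rw [(LinearMap.ringLmapEquivSelf A A A).length_eq, Module.length_eq_add_of_exact J.subtype J.mkQ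
    J.subtype_injective J.mkQ_surjective (LinearMap.exact_subtype_mkQ J)] at h1
  have h2 := hom_length_le s hs hs' (A ⧸ J) (fl _)
  have h3 := hom_length_le s hs hs' J (fl _)
  have h4 := Submodule.length_lt hne
  have h5 : Module.length A (A ⧸ J) ≠ ⊤ := Module.length_ne_top
  have h6 : Module.length A (A ⧸ J) + Module.length A J ≤ Module.length A (A ⧸ J) + Module.length A
     (LinearMap.range (LinearMap.lcomp A A J.subtype)) := by
    rw [add_comm, h1]
    exact add_le_add_left h2 _
  have h7 := (ENat.add_le_add_iff_left h5).mp h6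
  exact absurd (h4.trans_le (h3.trans h7)) (lt_irrefl _)

end SocAux
namespace SocAux

open scoped Pointwise

theorem divide {R K N : Type*} [CommRing R] [AddCommGroup K] [Module R K] [AddCommGroup N]
    [Module R N] (x : R) (hx : IsSMulRegular N x) (f : K →ₗ[R] N)
    (hf : ∀ k, f k ∈ x • (⊤ : Submodule R N)) : ∃ h : K →ₗ[R] N, f = x • h := by
  have hinj : Function.Injective (LinearMap.lsmul R N x) := hx
  let e := LinearEquiv.ofInjective (LinearMap.lsmul R N x) hinj
  have hf' : ∀ k, f k ∈ LinearMap.range (LinearMap.lsmul R N x) := by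
    intro k
    obtain ⟨n, -, hn⟩ := Submodule.mem_smul_pointwise_iff_exists _ _ _ |>.mp (hf k)
    exact ⟨n, hn⟩
  refine ⟨e.symm.toLinearMap ∘ₗ f.codRestrict _ hf', ?_⟩
  ext k
  have := congrArg Subtype.val (e.apply_symm_apply ⟨f k, hf' k⟩)
  exact this.symm

theorem ext_step {R F N : Type*} [CommRing R] [IsLocalRing R] [IsNoetherianRing R]
    [AddCommGroup F] [Module R F] [Module.Finite R F] [Module.Projective R F] (K : Submodule R F)
    [AddCommGroup N] [Module R N] [Module.Finite R N] (x : R) (hxm : x ∈ maximalIdeal R)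
    (hx : IsSMulRegular N x)
    (h : ∀ f : K →ₗ[R] QuotSMulTop x N, ∃ g : F →ₗ[R] QuotSMulTop x N, g ∘ₗ K.subtype = f)
    (f : K →ₗ[R] N) : ∃ g : F →ₗ[R] N, g ∘ₗ K.subtype = f := by
  have hle : (⊤ : Submodule R (K →ₗ[R] N)) ≤
      LinearMap.range (LinearMap.lcomp R N K.subtype) := by
    refine Submodule.le_of_le_smul_of_le_jacobson_bot (I := Ideal.span {x})
      (IsNoetherian.noetherian _) ?_ ?_
    · rw [Ideal.span_le, Set.singleton_subset_iff]
      exact maximalIdeal_le_jacobson _ hxm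
    · intro f _
      obtain ⟨g0, hg0⟩ := h ((x • (⊤ : Submodule R N)).mkQ ∘ₗ f)
      obtain ⟨g, hg⟩ := Module.projective_lifting_property (x • (⊤ : Submodule R N)).mkQ g0
        (Submodule.mkQ_surjective _)
      obtain ⟨q, hq⟩ := divide x hx (f - g ∘ₗ K.subtype) (by
        intro k
        rw [← Submodule.Quotient.mk_eq_zero, ← Submodule.mkQ_apply]
        have h1 := LinearMap.congr_fun hg0 k
        have h2 := LinearMap.congr_fun hg k
        simp only [LinearMap.comp_apply] at h1 h2
        rw [LinearMap.sub_apply, map_sub, ← h1, LinearMap.comp_apply]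
        exact sub_eq_zero.mpr h2.symm)
      rw [sub_eq_iff_eq_add'] at hq
      rw [hq]
      exact Submodule.add_mem_sup ⟨g, rfl⟩
        (Submodule.smul_mem_smul (Ideal.mem_span_singleton_self x) trivial)
  exact hle (x := f) trivial

theorem lift_step {R F M N : Type*} [CommRing R]
    [AddCommGroup F] [Module R F] [Module.Projective R F]
    [AddCommGroup M] [Module R M] (π : F →ₗ[R] M) (hπ : Function.Surjective π)
    [AddCommGroup N] [Module R N] (x : R)
    (hx : IsSMulRegular N x)
    (h : ∀ f : LinearMap.ker π →ₗ[R] N, ∃ g : F →ₗ[R] N, g ∘ₗ (LinearMap.ker π).subtype = f)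
    (φ : M →ₗ[R] QuotSMulTop x N) :
    ∃ ψ : M →ₗ[R] N, (x • (⊤ : Submodule R N)).mkQ ∘ₗ ψ = φ := by
  obtain ⟨g, hg⟩ := Module.projective_lifting_property (x • (⊤ : Submodule R N)).mkQ (φ ∘ₗ π)
    (Submodule.mkQ_surjective _)
  obtain ⟨q, hq⟩ := divide x hx (g ∘ₗ (LinearMap.ker π).subtype) (by
    intro k
    rw [← Submodule.Quotient.mk_eq_zero, ← Submodule.mkQ_apply]
    refine (LinearMap.congr_fun hg k).trans ?_
    rw [LinearMap.comp_apply, LinearMap.mem_ker.mp k.2, map_zero])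
  obtain ⟨q', hq'⟩ := h q
  let ψ0 : (F ⧸ LinearMap.ker π) →ₗ[R] N := (LinearMap.ker π).liftQ (g - x • q') (by
    intro k hk
    have h1 := LinearMap.congr_fun hq ⟨k, hk⟩
    have h2 := LinearMap.congr_fun hq' ⟨k, hk⟩
    simp only [LinearMap.comp_apply, Submodule.subtype_apply, LinearMap.smul_apply] at h1 h2
    simp [h1, h2])
  let e := π.quotKerEquivOfSurjective hπ
  have he : ∀ u, e.symm (π u) = (LinearMap.ker π).mkQ u := by
    intro u
    rw [LinearEquiv.symm_apply_eq]; rfl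
  refine ⟨ψ0 ∘ₗ e.symm.toLinearMap, ?_⟩
  ext m
  obtain ⟨u, rfl⟩ := hπ m
  simp only [LinearMap.comp_apply, LinearEquiv.coe_coe, he]
  have h3 : ψ0 ((LinearMap.ker π).mkQ u) = g u - x • q' u := rfl
  have h4 : (x • (⊤ : Submodule R N)).mkQ (x • q' u) = 0 := by
    rw [Submodule.mkQ_apply, Submodule.Quotient.mk_eq_zero]
    exact Submodule.smul_mem_pointwise_smul _ _ _ trivial
  rw [h3, map_sub, h4, sub_zero]
  exact LinearMap.congr_fun hg u

theorem ext_list {R F M Q : Type*} [CommRing R] [IsLocalRing R] [IsNoetherianRing R]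
    [AddCommGroup F] [Module R F] [Module.Finite R F] [Module.Projective R F]
    [AddCommGroup M] [Module R M] (π : F →ₗ[R] M) (hπ : Function.Surjective π)
    [AddCommGroup Q] [Module R Q]
    (h : ∀ f : LinearMap.ker π →ₗ[R] Q, ∃ g : F →ₗ[R] Q, g ∘ₗ (LinearMap.ker π).subtype = f)
    (φ : M →ₗ[R] Q) (rs : List R) :
    ∀ (N : Type _) [AddCommGroup N] [Module R N] [Module.Finite R N] (p : N →ₗ[R] Q),
      Function.Surjective p → LinearMap.ker p = Ideal.ofList rs • ⊤ →
      (∀ a ∈ rs, a ∈ maximalIdeal R) → RingTheory.Sequence.IsWeaklyRegular N rs →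
      (∀ f : LinearMap.ker π →ₗ[R] N, ∃ g : F →ₗ[R] N, g ∘ₗ (LinearMap.ker π).subtype = f) ∧
      ∃ ψ : M →ₗ[R] N, p ∘ₗ ψ = φ := by
  induction rs with
  | nil =>
    intro N _ _ _ p hp hk _ _
    rw [Ideal.ofList_nil, Submodule.bot_smul] at hk
    let e := LinearEquiv.ofBijective p ⟨LinearMap.ker_eq_bot.mp hk, hp⟩
    have he : ∀ q, p (e.symm q) = q := e.apply_symm_apply
    have he' : ∀ n, e.symm (p n) = n := e.symm_apply_apply
    constructor
    · intro f
      obtain ⟨g, hg⟩ := h (p ∘ₗ f)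
      refine ⟨e.symm.toLinearMap ∘ₗ g, ?_⟩
      rw [LinearMap.comp_assoc, hg]
      ext k
      exact he' _
    · refine ⟨e.symm.toLinearMap ∘ₗ φ, ?_⟩
      ext m
      exact he _
  | cons r rs ih =>
    intro N _ _ _ p hp hk hm hreg
    rw [RingTheory.Sequence.isWeaklyRegular_cons_iff] at hreg
    simp only [List.mem_cons, forall_eq_or_imp] at hm
    rw [Ideal.ofList_cons_smul] at hk
    let p' : QuotSMulTop r N →ₗ[R] Q := (r • (⊤ : Submodule R N)).liftQ p (by
      rw [hk]; exact le_sup_left)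
    have hp' : Function.Surjective p' := by
      intro q
      obtain ⟨n, rfl⟩ := hp q
      exact ⟨(r • (⊤ : Submodule R N)).mkQ n, rfl⟩
    have hk' : LinearMap.ker p' = Ideal.ofList rs • ⊤ := by
      rw [Submodule.ker_liftQ, hk, Submodule.map_sup, Submodule.map_smul'', Submodule.map_top,
        Submodule.range_mkQ, Submodule.mkQ_map_self, bot_sup_eq]
    obtain ⟨h1, ψ, hψ⟩ := ih (QuotSMulTop r N) p' hp' hk' hm.2 hreg.2
    have h2 := ext_step (LinearMap.ker π) r hm.1 hreg.1 h1
    refine ⟨h2, ?_⟩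
    obtain ⟨ψ', hψ'⟩ := lift_step π hπ r hreg.1 h2 ψ
    refine ⟨ψ', ?_⟩
    rw [← hψ, ← hψ']
    rfl

theorem baer_ext {R P P' : Type*} [CommRing R] (I : Ideal R) (hB : Module.Baer (R ⧸ I) (R ⧸ I))
    [AddCommGroup P] [Module R P] [AddCommGroup P'] [Module R P'] (i : P →ₗ[R] P')
    (hi : ∀ u, i u ∈ I • (⊤ : Submodule R P') → u ∈ I • (⊤ : Submodule R P))
    (f : P →ₗ[R] R ⧸ I) : ∃ g : P' →ₗ[R] R ⧸ I, g ∘ₗ i = f := by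
  have hs : Function.Surjective (algebraMap R (R ⧸ I)) := Ideal.Quotient.mk_surjective
  let i0 : (P ⧸ I • (⊤ : Submodule R P)) →ₗ[R] (P' ⧸ I • (⊤ : Submodule R P')) :=
    Submodule.mapQ _ _ i (by
      rw [← Submodule.map_le_iff_le_comap, Submodule.map_smul'']
      exact Submodule.smul_mono le_rfl le_top)
  have hi0 : Function.Injective i0 := by
    rw [injective_iff_map_eq_zero]
    intro u hu
    obtain ⟨u, rfl⟩ := Submodule.mkQ_surjective _ u
    rw [Submodule.mkQ_apply, Submodule.Quotient.mk_eq_zero]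
    apply hi
    rwa [Submodule.mkQ_apply, Submodule.mapQ_apply, Submodule.Quotient.mk_eq_zero] at hu
  let f0 : (P ⧸ I • (⊤ : Submodule R P)) →ₗ[R] R ⧸ I := Submodule.liftQ _ f (by
    rw [Submodule.smul_le]
    intro r hr n _
    rw [LinearMap.mem_ker, map_smul, Algebra.smul_def, Ideal.Quotient.algebraMap_eq,
      Ideal.Quotient.eq_zero_iff_mem.mpr hr, zero_mul])
  obtain ⟨g, hg⟩ := hB.extension_property (LinearMap.extendScalarsOfSurjective hs i0) hi0
    (LinearMap.extendScalarsOfSurjective hs f0)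
  refine ⟨g.restrictScalars R ∘ₗ Submodule.mkQ _, ?_⟩
  ext u
  exact LinearMap.congr_fun hg (Submodule.mkQ _ u)

theorem tor_van {R F M : Type*} [CommRing R]
    [AddCommGroup F] [Module R F] 
    [AddCommGroup M] [Module R M] (π : F →ₗ[R] M) (hπ : Function.Surjective π)
    (rs : List R) (h : RingTheory.Sequence.IsWeaklyRegular M rs) (u : LinearMap.ker π)
    (hu : (LinearMap.ker π).subtype u ∈ Ideal.ofList rs • (⊤ : Submodule R F)) :
    u ∈ Ideal.ofList rs • (⊤ : Submodule R (LinearMap.ker π)) := by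
  have hex := RingTheory.Sequence.map_first_exact_on_four_term_right_exact_of_isSMulRegular_last
    (f₁ := (0 : PUnit →ₗ[R] LinearMap.ker π)) (f₂ := (LinearMap.ker π).subtype) (f₃ := π)
    (by
      intro y
      constructor
      · intro h
        exact ⟨0, by rw [map_zero]; exact (Subtype.ext h).symm⟩
      · rintro ⟨_, rfl⟩; rfl) (LinearMap.exact_subtype_ker_map π) hπ h
  have := (hex (Submodule.Quotient.mk u)).mp (by
    rw [Submodule.mapQ_apply, Submodule.Quotient.mk_eq_zero]; exact hu)
  obtain ⟨w, hw⟩ := this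
  obtain ⟨w, rfl⟩ := Submodule.mkQ_surjective _ w
  rw [Submodule.mkQ_apply, Submodule.mapQ_apply, LinearMap.zero_apply,
    Submodule.Quotient.mk_zero] at hw
  exact (Submodule.Quotient.mk_eq_zero _).mp hw.symm

end SocAux
namespace SocAux

theorem quot_baer {R : Type*} [CommRing R] [IsLocalRing R] [IsNoetherianRing R] (I : Ideal R)
    (hI : IsMPrimary I) (Δ : R)
    (hΔ : Submodule.colon I (maximalIdeal R) = I ⊔ Ideal.span {Δ}) :
    Module.Baer (R ⧸ I) (R ⧸ I) := by
  obtain ⟨hne, n, hn⟩ := hI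
  have hIm := le_maximalIdeal hne
  have : Nontrivial (R ⧸ I) := Ideal.Quotient.nontrivial_iff.mpr hne
  have : IsLocalRing (R ⧸ I) :=
    IsLocalRing.of_surjective' (Ideal.Quotient.mk I) Ideal.Quotient.mk_surjective
  have : IsArtinianRing (R ⧸ I) := by
    apply quotient_artinian_of_mem_minimalPrimes_of_isLocalRing
    refine ⟨⟨inferInstance, hIm⟩, ?_⟩
    rintro q ⟨hq, hq2⟩ _
    exact hq.le_of_pow_le (hn.trans hq2)
  have hmem : ∀ r ∈ maximalIdeal R, Ideal.Quotient.mk I r ∈ maximalIdeal (R ⧸ I) := by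
    intro r hr
    rw [mem_maximalIdeal]
    intro hu
    obtain ⟨t, ht⟩ := hu.exists_right_inv
    obtain ⟨t, rfl⟩ := Ideal.Quotient.mk_surjective t
    rw [← map_mul, ← map_one (Ideal.Quotient.mk I), Ideal.Quotient.eq] at ht
    have h1 := Ideal.sub_mem _ (Ideal.mul_mem_right t _ hr) (hIm ht)
    rw [sub_sub_cancel] at h1
    exact (Ideal.ne_top_iff_one _).mp (maximalIdeal.isMaximal R).ne_top h1
  refine baer (Ideal.Quotient.mk I Δ) ?_ ?_
  · intro m hm
    obtain ⟨r, rfl⟩ := Ideal.Quotient.mk_surjective m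
    have hr : r ∈ maximalIdeal R := fun hu => hm (hu.map _)
    have hD : Δ ∈ Submodule.colon I (maximalIdeal R) := by
      rw [hΔ]; exact Ideal.mem_sup_right (Ideal.mem_span_singleton_self Δ)
    rw [← map_mul, Ideal.Quotient.eq_zero_iff_mem, mul_comm]
    exact Submodule.mem_colon.mp hD r hr
  · intro a ha
    obtain ⟨b, rfl⟩ := Ideal.Quotient.mk_surjective a
    have hb : b ∈ Submodule.colon I (maximalIdeal R) := by
      rw [Submodule.mem_colon]
      intro r hr
      have := ha _ (hmem r hr)
      rwa [← map_mul, Ideal.Quotient.eq_zero_iff_mem, mul_comm] at this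
    rw [hΔ] at hb
    obtain ⟨i, hi, w, hw, rfl⟩ := Submodule.mem_sup.mp hb
    obtain ⟨c, rfl⟩ := Ideal.mem_span_singleton'.mp hw
    rw [map_add, Ideal.Quotient.eq_zero_iff_mem.mpr hi, zero_add, map_mul]
    exact Ideal.mul_mem_left _ _ (Ideal.mem_span_singleton_self _)

theorem socle_inj {R : Type*} [CommRing R] [IsLocalRing R] (I : Ideal R)
    (hI : IsMPrimary I) (Δ : R)
    (hΔ : Submodule.colon I (maximalIdeal R) = I ⊔ Ideal.span {Δ})
    {M : Type*} [AddCommGroup M] [Module R M] (x : M)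
    (hx : Δ • x ∉ I • (⊤ : Submodule R M)) (u : R) (hu : u • x ∈ I • (⊤ : Submodule R M)) :
    u ∈ I := by
  classical
  by_contra hui
  obtain ⟨hne, n, hn⟩ := hI
  have hex : ∃ k : ℕ, ∀ a ∈ maximalIdeal R ^ k, a * u ∈ I :=
    ⟨n, fun a ha => Ideal.mul_mem_right _ _ (hn ha)⟩
  have hk := Nat.find_spec hex
  have hmin := fun j => Nat.find_min hex (m := j)
  generalize Nat.find hex = k at hk hmin
  obtain _ | k := k
  · exact hui (by simpa using hk 1 (by simp))
  have := hmin k (Nat.lt_succ_self k)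
  push Not at this
  obtain ⟨a, ha, hau⟩ := this
  have hb : a * u ∈ Submodule.colon I (maximalIdeal R) := by
    rw [Submodule.mem_colon]
    intro r hr
    have h1 := hk (a * r) (by rw [pow_succ]; exact Ideal.mul_mem_mul ha hr)
    rw [smul_eq_mul]
    convert h1 using 1
    ring
  rw [hΔ] at hb
  obtain ⟨i, hi, w, hw, e⟩ := Submodule.mem_sup.mp hb
  obtain ⟨c, rfl⟩ := Ideal.mem_span_singleton'.mp hw
  have hD : Δ ∈ Submodule.colon I (maximalIdeal R) := by
    rw [hΔ]; exact Ideal.mem_sup_right (Ideal.mem_span_singleton_self Δ)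
  have hc : IsUnit c := by
    by_contra hc
    apply hau
    rw [← e]
    refine Ideal.add_mem _ hi ?_
    rw [mul_comm]
    exact Submodule.mem_colon.mp hD c hc
  obtain ⟨c', hc'⟩ := hc.exists_left_inv
  apply hx
  have e2 : Δ • x = c' • (a • (u • x) - i • x) := by
    rw [smul_smul a u x, ← sub_smul, smul_smul]
    congr 1
    linear_combination (-Δ) * hc' + c' * e
  rw [e2]
  exact Submodule.smul_mem _ _ (Submodule.sub_mem _ (Submodule.smul_mem _ _ hu)
    (Submodule.smul_mem_smul hi trivial))

end SocAux

theorem socle_smul_subset_of_no_free_summand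
    (R : Type*) [CommRing R] [IsLocalRing R] [IsNoetherianRing R]
    (hGor : IsGorensteinLocal R)
    (M : Type*) [AddCommGroup M] [Module R M] [Module.Finite R M]
    (hMCM : IsMaximalCM R M)
    (hnofree : ∀ f : M →ₗ[R] R, ¬ Function.Surjective f)
    (xs : List R) (hxs : IsSOP xs) (I : Ideal R) (hI : I = Ideal.ofList xs)
    (Δ : R) (hΔ : Submodule.colon I (maximalIdeal R) = I ⊔ Ideal.span {Δ}) :
    ∀ x : M, Δ • x ∈ I • (⊤ : Submodule R M) := by
  intro x
  by_contra hx
  obtain ⟨ys, hys, hyreg, -⟩ := hGor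
  have inm : ∀ l : List R, IsSOP l → ∀ a ∈ l, a ∈ maximalIdeal R := fun l hl a ha =>
    le_maximalIdeal hl.2.1 (Ideal.subset_span ha)
  have rad : ∀ l : List R, IsSOP l → maximalIdeal R ≤ (Ideal.ofList l).radical := by
    intro l hl
    obtain ⟨n, hn⟩ := hl.2.2
    exact fun a ha => ⟨n, hn (Ideal.pow_mem_pow ha n)⟩
  have hlen : ys.length = xs.length := by
    have := hys.1.trans hxs.1.symm
    exact_mod_cast this
  have hxreg : RingTheory.Sequence.IsWeaklyRegular R xs :=
    SocAux.cm_aux xs [] ys hlen (by simpa using hxs.1) (by simp) (inm ys hys) (inm xs hxs)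
      hyreg.toIsWeaklyRegular (rad ys hys) (rad xs hxs)
  have hP : IsMPrimary I := hI ▸ hxs.2
  have hB := SocAux.quot_baer I hP Δ hΔ
  -- splitting
  obtain ⟨φ, hφ⟩ := SocAux.baer_ext I hB (LinearMap.toSpanSingleton R M x)
    (fun u hu => by
      have := SocAux.socle_inj I hP Δ hΔ x hx u hu
      simpa using this) (Submodule.mkQ I)
  obtain ⟨n, π, hπ⟩ := Module.Finite.exists_fin' R M
  have hext : ∀ f : LinearMap.ker π →ₗ[R] R ⧸ I, ∃ g : (Fin n → R) →ₗ[R] R ⧸ I,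
      g ∘ₗ (LinearMap.ker π).subtype = f := by
    intro f
    refine SocAux.baer_ext I hB _ ?_ f
    subst hI
    exact SocAux.tor_van π hπ xs (hMCM xs hxs).toIsWeaklyRegular
  obtain ⟨-, ψ, hψ⟩ := SocAux.ext_list π hπ hext φ xs R (Submodule.mkQ I)
    (Submodule.mkQ_surjective _) (by rw [Submodule.ker_mkQ, ← hI]; simp) (inm xs hxs) hxreg
  have h1 : Submodule.mkQ I (ψ x) = Submodule.mkQ I 1 := by
    have a := LinearMap.congr_fun hψ x
    have b := LinearMap.congr_fun hφ 1
    simp only [LinearMap.comp_apply, LinearMap.toSpanSingleton_apply, one_smul] at a b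
    rw [a, b]
  have h2 : ψ x - 1 ∈ I := (Submodule.Quotient.eq I).mp h1
  have hu : IsUnit (ψ x) := by
    by_contra hu
    have h3 := Ideal.sub_mem _ ((mem_maximalIdeal _).mpr hu) (le_maximalIdeal hP.1 h2)
    rw [sub_sub_cancel] at h3
    exact (Ideal.ne_top_iff_one _).mp (maximalIdeal.isMaximal R).ne_top h3
  obtain ⟨c, hc⟩ := hu.exists_left_inv
  refine hnofree ψ fun r => ⟨(r * c) • x, ?_⟩
  rw [map_smul, smul_eq_mul, mul_assoc, hc, mul_one]
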